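/- arXiv:2312.16841 — 2 statements merged into one kernel-verified Lean document; each statement's English description precedes it below -/
import Mathlib

section
/- Let D be a weighted oriented graph such that every vertex of weight greater than 1 is a sink, and let G be the underlying simple (unweighted, unoriented treated with all weights 1) graph of D. Then the toric ideals coincide: I_D = I_G. -/
open MvPolynomial Finset

/-- The "positive part" `∏ e, X e ^ (b e)⁺` of the binomial associated to an
integer vector `b`. -/
noncomputable def binomPlus (K : Type*) [Field K] {ι : Type*} [Fintype ι]
    (b : ι → ℤ) : MvPolynomial ι K :=
  ∏ e, X e ^ (b e).toNat

/-- The "negative part" `∏ e, X e ^ (b e)⁻` of the binomial associated to an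
integer vector `b`. -/
noncomputable def binomMinus (K : Type*) [Field K] {ι : Type*} [Fintype ι]
    (b : ι → ℤ) : MvPolynomial ι K :=
  ∏ e, X e ^ (-b e).toNat

/-- The (pure) binomial `f_b = f_b⁺ - f_b⁻` associated to an integer vector `b`. -/
noncomputable def binom (K : Type*) [Field K] {ι : Type*} [Fintype ι]
    (b : ι → ℤ) : MvPolynomial ι K :=
  binomPlus K b - binomMinus K b

/-- Support of an integer vector. -/
def vsupp {ι : Type*} (b : ι → ℤ) : Set ι := {e | b e ≠ 0}

/-- `f_b` is a primitive binomial of the ideal `I`. -/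
def IsPrimitiveIn (K : Type*) [Field K] {ι : Type*} [Fintype ι]
    (I : Ideal (MvPolynomial ι K)) (b : ι → ℤ) : Prop :=
  b ≠ 0 ∧ binom K b ∈ I ∧
    ∀ c : ι → ℤ, c ≠ 0 → binom K c ∈ I →
      binomPlus K c ∣ binomPlus K b → binomMinus K c ∣ binomMinus K b → c = b

/-- A (vertex-)weighted oriented graph: finite sets of vertices and edges, each
edge `e` oriented from `src e` to `tgt e`, no loops, no parallel edges, and a
positive integer weight attached to every vertex. -/
structure WOGraph (V E : Type*) where
  src : E → V
  tgt : E → V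
  w : V → ℕ
  no_loop : ∀ e, src e ≠ tgt e
  no_parallel : ∀ e e' : E, s(src e, tgt e) = s(src e', tgt e') → e = e'
  wpos : ∀ v, 0 < w v

namespace WOGraph

variable {V E : Type*}

/-- The toric ideal `I_D` of a weighted oriented graph: the kernel of
`K[e : e ∈ E(D)] → K[x : x ∈ V(D)]`, `e = (x_i,x_j) ↦ x_i x_j ^ w_j`. -/
noncomputable def toricIdeal (D : WOGraph V E) (K : Type*) [Field K] :
    Ideal (MvPolynomial E K) :=
  RingHom.ker (aeval (R := K)
    (fun e => X (D.src e) * X (D.tgt e) ^ D.w (D.tgt e)) :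
      MvPolynomial E K →ₐ[K] MvPolynomial V K).toRingHom

/-- The edge `e` is incident with the vertex `v`. -/
def incident (D : WOGraph V E) (v : V) (e : E) : Prop :=
  D.src e = v ∨ D.tgt e = v

/-- Degree of a vertex. -/
noncomputable def degree (D : WOGraph V E) (v : V) : ℕ :=
  Set.ncard {e : E | D.incident v e}

/-- A leaf is a vertex of degree 1. -/
def IsLeaf (D : WOGraph V E) (v : V) : Prop := D.degree v = 1

/-- A sink is a vertex of outdegree 0. -/
def IsSink (D : WOGraph V E) (v : V) : Prop := ∀ e, D.src e ≠ v

/-- The Graver basis `Gr_D`: the set of primitive binomials of `I_D`. -/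
def graverSet (D : WOGraph V E) (K : Type*) [Field K] [Fintype E] :
    Set (MvPolynomial E K) :=
  {f | ∃ b : E → ℤ, f = binom K b ∧ IsPrimitiveIn K (D.toricIdeal K) b}

/-- The set `C_D` of circuits of `I_D`: irreducible binomials of `I_D` with
minimal support. -/
def circuitSet (D : WOGraph V E) (K : Type*) [Field K] [Fintype E] :
    Set (MvPolynomial E K) :=
  {f | ∃ b : E → ℤ, f = binom K b ∧ b ≠ 0 ∧ binom K b ∈ D.toricIdeal K ∧
      (Finset.univ.gcd fun e => (b e).natAbs) = 1 ∧
      ∀ c : E → ℤ, c ≠ 0 → binom K c ∈ D.toricIdeal K →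
        vsupp c ⊆ vsupp b → vsupp c = vsupp b}

/-- Cyclic successor on `Fin n`. -/
def finRot {n : ℕ} (i : Fin n) : Fin n := ⟨((i : ℕ) + 1) % n, Nat.mod_lt _ i.pos⟩

/-- A cycle of length `n ≥ 3` in a weighted oriented graph `D`, with its usual
labelling: the edge `edge i` joins the vertices `vert i` and `vert (i+1)`
(indices cyclically). -/
structure CycleIn (D : WOGraph V E) where
  n : ℕ
  hn : 3 ≤ n
  vert : Fin n → V
  edge : Fin n → E
  vinj : Function.Injective vert
  einj : Function.Injective edge
  hinc : ∀ i : Fin n, s(D.src (edge i), D.tgt (edge i)) = s(vert i, vert (finRot i))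

/-- A path of length `k ≥ 1` in `D`, with its usual labelling: the edge `edge i`
joins `vert i` and `vert (i+1)`. -/
structure PathIn (D : WOGraph V E) where
  k : ℕ
  hk : 1 ≤ k
  vert : Fin (k + 1) → V
  edge : Fin k → E
  vinj : Function.Injective vert
  einj : Function.Injective edge
  hinc : ∀ i : Fin k, s(D.src (edge i), D.tgt (edge i)) = s(vert i.castSucc, vert i.succ)

variable [DecidableEq V]

/-- The incidence entry of a vertex `v` and an edge `e`: `1` if `e` leaves `v`,
`w v` if `e` enters `v`, `0` otherwise. -/
def inc (D : WOGraph V E) (v : V) (e : E) : ℤ :=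
  if D.src e = v then 1 else if D.tgt e = v then (D.w v : ℤ) else 0

/-- The incidence matrix of a cycle in `D` (with respect to its usual labelling). -/
def CycleIn.mat {D : WOGraph V E} (C : CycleIn D) : Matrix (Fin C.n) (Fin C.n) ℤ :=
  fun i j => D.inc (C.vert i) (C.edge j)

/-- A cycle is balanced if its incidence matrix is singular. -/
def CycleIn.IsBalanced {D : WOGraph V E} (C : CycleIn D) : Prop := C.mat.det = 0

/-- A cycle is unbalanced if its incidence matrix is nonsingular. -/
def CycleIn.IsUnbalanced {D : WOGraph V E} (C : CycleIn D) : Prop := C.mat.det ≠ 0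

end WOGraph

namespace WOGraph

variable {V E : Type*}

/-- Two cycles share exactly one vertex. -/
def ShareOneVertex {D : WOGraph V E} (C₁ C₂ : CycleIn D) : Prop :=
  (∃ v : V, Set.range C₁.vert ∩ Set.range C₂.vert = {v}) ∧
    Set.range C₁.edge ∩ Set.range C₂.edge = ∅

/-- Two cycles share the path `P`. -/
def SharePath {D : WOGraph V E} (C₁ C₂ : CycleIn D) (P : PathIn D) : Prop :=
  Set.range P.edge ⊆ Set.range C₁.edge ∧ Set.range P.edge ⊆ Set.range C₂.edge ∧
    Set.range C₁.edge ∩ Set.range C₂.edge = Set.range P.edge ∧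
    Set.range C₁.vert ∩ Set.range C₂.vert = Set.range P.vert

/-- Two (disjoint) cycles are connected by the path `P`, which meets `C₁` only in
its first vertex and `C₂` only in its last vertex. -/
def ConnectedByPath {D : WOGraph V E} (C₁ C₂ : CycleIn D) (P : PathIn D) : Prop :=
  Set.range C₁.vert ∩ Set.range C₂.vert = ∅ ∧
    P.vert 0 ∈ Set.range C₁.vert ∧ P.vert (Fin.last P.k) ∈ Set.range C₂.vert ∧
    (∀ i : Fin (P.k + 1), i ≠ 0 → P.vert i ∉ Set.range C₁.vert) ∧
    (∀ i : Fin (P.k + 1), i ≠ Fin.last P.k → P.vert i ∉ Set.range C₂.vert) ∧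
    Set.range P.edge ∩ (Set.range C₁.edge ∪ Set.range C₂.edge) = ∅

/-- `f` is the primitive binomial generator of the (principal) toric ideal of the
subgraph of `D` with edge set `S` (identified with the binomials of `I_D`
supported in `S`). -/
def IsPrimGenOn (D : WOGraph V E) (K : Type*) [Field K] [Fintype E]
    (S : Set E) (f : MvPolynomial E K) : Prop :=
  ∃ b : E → ℤ, f = binom K b ∧ b ≠ 0 ∧ vsupp b ⊆ S ∧ binom K b ∈ D.toricIdeal K ∧
    (∀ c : E → ℤ, c ≠ 0 → vsupp c ⊆ S → binom K c ∈ D.toricIdeal K →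
      binomPlus K c ∣ binomPlus K b → binomMinus K c ∣ binomMinus K b → c = b) ∧
    (∀ g : MvPolynomial E K, g ∈ D.toricIdeal K →
      (∀ m ∈ g.support, ∀ e : E, m e ≠ 0 → e ∈ S) → g ∈ Ideal.span {f})

end WOGraph

/-- The substitution `X v ↦ X v ^ w v` with positive exponents is injective. -/
theorem MvPolynomial.aeval_X_pow_injective {σ : Type*} (K : Type*) [Field K] (w : σ → ℕ)
    (hw : ∀ v, 0 < w v) :
    Function.Injective
      (aeval (R := K) fun v => (X v : MvPolynomial σ K) ^ w v) := by
  have h := (algebraicIndependent_X σ K).polynomial_aeval_of_transcendental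
    (f := fun v => Polynomial.X ^ w v) fun v => (Polynomial.transcendental_X K).pow (hw v)
  simpa [AlgebraicIndependent] using h

/-- Corollary 3.9. If every vertex of `D` of weight `> 1` is a
sink, and `G` is the underlying simple graph of `D` (same edges, all weights
`1`, orientations irrelevant since an edge `{x_i, x_j}` maps to `x_i x_j`),
then `I_D = I_G`. -/
theorem stmt8 {V E : Type*} [Fintype V] [Fintype E] (K : Type*) [Field K]
    (D : WOGraph V E) (hplus : ∀ v : V, 1 < D.w v → D.IsSink v)
    (G : WOGraph V E) (hsrc : G.src = D.src) (htgt : G.tgt = D.tgt)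
    (hw : ∀ v : V, G.w v = 1) :
    D.toricIdeal K = G.toricIdeal K := by
  have key : (aeval (R := K) fun e => X (D.src e) * X (D.tgt e) ^ D.w (D.tgt e) :
      MvPolynomial E K →ₐ[K] MvPolynomial V K) =
      (aeval (R := K) fun v => (X v : MvPolynomial V K) ^ D.w v).comp
        (aeval (R := K) fun e => X (G.src e) * X (G.tgt e) ^ G.w (G.tgt e)) := by
    ext1 e
    have h1 : D.w (D.src e) = 1 :=
      le_antisymm (not_lt.1 fun h => hplus _ h e rfl) (D.wpos _)
    simp [hsrc, htgt, hw, h1]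
  ext f
  have hf := (MvPolynomial.aeval_X_pow_injective K D.w D.wpos).eq_iff'
    (map_zero _) (a := aeval (R := K)
      (fun e => (X (G.src e) : MvPolynomial V K) * X (G.tgt e) ^ G.w (G.tgt e)) f)
  simpa only [WOGraph.toricIdeal, key, RingHom.mem_ker, AlgHom.toRingHom_eq_coe,
    RingHom.coe_coe, AlgHom.comp_apply] using hf
end

section
/- Let A be an n×m matrix with non-negative integer entries whose null space over ℚ has dimension 1, and let f_a ∈ I_A be a pure binomial for a ∈ ℤ^m. Let d = gcd(|a_i| : i ∈ supp(a)). Then f_{(1/d)a} is a primitive binomial and it generates I_A. -/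
open MvPolynomial Finset

/-- The toric ideal of an `n × m` matrix of non-negative integers: the kernel of
`K[e_1,…,e_m] → K[x_1,…,x_n]`, `e_j ↦ ∏ i, x_i ^ (A i j)`. -/
noncomputable def matToricIdeal (K : Type*) [Field K] {n m : ℕ}
    (A : Matrix (Fin n) (Fin m) ℕ) : Ideal (MvPolynomial (Fin m) K) :=
  RingHom.ker (aeval (R := K)
    (fun j => ∏ i, X i ^ A i j) :
      MvPolynomial (Fin m) K →ₐ[K] MvPolynomial (Fin n) K).toRingHom

/-- The exponent vector of the image of the monomial with exponent `u`. -/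
noncomputable def toricDegree {n m : ℕ} (A : Matrix (Fin n) (Fin m) ℕ) (u : Fin m →₀ ℕ) :
    Fin n →₀ ℕ :=
  Finsupp.equivFunOnFinite.symm fun i => ∑ j, A i j * u j

/-- The exponent vector of the positive part of an integer vector. -/
noncomputable def posExponent {ι : Type*} [Fintype ι] (b : ι → ℤ) : ι →₀ ℕ :=
  Finsupp.equivFunOnFinite.symm fun e => (b e).toNat

theorem prod_X_pow_eq_monomial_equivFunOnFinite (K : Type*) [Field K] {ι : Type*} [Fintype ι]
    (f : ι → ℕ) :
    (∏ e, X e ^ f e : MvPolynomial ι K) = monomial (Finsupp.equivFunOnFinite.symm f) 1 := by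
  rw [monomial_eq, Finsupp.prod_fintype _ _ (by simp)]
  simp

theorem binomPlus_eq_monomial (K : Type*) [Field K] {ι : Type*} [Fintype ι] (b : ι → ℤ) :
    binomPlus K b = monomial (posExponent b) 1 :=
  prod_X_pow_eq_monomial_equivFunOnFinite K _

theorem binomMinus_eq_monomial (K : Type*) [Field K] {ι : Type*} [Fintype ι] (b : ι → ℤ) :
    binomMinus K b = monomial (posExponent (-b)) 1 :=
  prod_X_pow_eq_monomial_equivFunOnFinite K _

theorem aeval_monomial_eq_toricDegree (K : Type*) [Field K] {n m : ℕ}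
    (A : Matrix (Fin n) (Fin m) ℕ) (u : Fin m →₀ ℕ) :
    aeval (R := K) (fun j => (∏ i, X i ^ A i j : MvPolynomial (Fin n) K)) (monomial u 1) =
      monomial (toricDegree A u) 1 := by
  rw [aeval_monomial, Finsupp.prod_fintype _ _ (by simp), toricDegree,
    ← prod_X_pow_eq_monomial_equivFunOnFinite]
  simp only [map_one, one_mul, ← Finset.prod_pow, ← pow_mul]
  rw [Finset.prod_comm]
  simp only [Finset.prod_pow_eq_pow_sum]

theorem mem_matToricIdeal (K : Type*) [Field K] {n m : ℕ} (A : Matrix (Fin n) (Fin m) ℕ)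
    (p : MvPolynomial (Fin m) K) :
    p ∈ matToricIdeal K A ↔
      aeval (R := K) (fun j => (∏ i, X i ^ A i j : MvPolynomial (Fin n) K)) p = 0 :=
  Iff.rfl

theorem toricDegree_eq_iff {n m : ℕ} (A : Matrix (Fin n) (Fin m) ℕ) (u v : Fin m →₀ ℕ) :
    toricDegree A u = toricDegree A v ↔ ∀ i, ∑ j, (A i j : ℤ) * ((u j : ℤ) - v j) = 0 := by
  simp only [toricDegree, EmbeddingLike.apply_eq_iff_eq, funext_iff, mul_sub,
    Finset.sum_sub_distrib, sub_eq_zero]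
  exact forall_congr' fun i => by norm_cast

theorem binom_mem_matToricIdeal (K : Type*) [Field K] {n m : ℕ} (A : Matrix (Fin n) (Fin m) ℕ)
    (b : Fin m → ℤ) :
    binom K b ∈ matToricIdeal K A ↔ ∀ i, ∑ j, (A i j : ℤ) * b j = 0 := by
  rw [mem_matToricIdeal, binom, binomPlus_eq_monomial, binomMinus_eq_monomial, map_sub,
    aeval_monomial_eq_toricDegree, aeval_monomial_eq_toricDegree, sub_eq_zero,
    (monomial_left_injective (one_ne_zero (α := K))).eq_iff, toricDegree_eq_iff]
  simp [posExponent]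

/-- An ideal containing every binomial `e^u - e^v` with `u` and `v` of equal degree contains the
toric ideal. -/
theorem matToricIdeal_le (K : Type*) [Field K] {n m : ℕ} (A : Matrix (Fin n) (Fin m) ℕ)
    (J : Ideal (MvPolynomial (Fin m) K))
    (hJ : ∀ u v, toricDegree A u = toricDegree A v →
      (monomial u 1 - monomial v 1 : MvPolynomial (Fin m) K) ∈ J) :
    matToricIdeal K A ≤ J := by
  let ψ : MvPolynomial (Fin n) K →ₗ[K] MvPolynomial (Fin m) K ⧸ J :=
    (basisMonomials (Fin n) K).constr K fun t =>
      Ideal.Quotient.mkₐ K J (monomial (Function.invFun (toricDegree A) t) 1)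
  have hψ : ψ ∘ₗ (aeval (R := K)
      (fun j => (∏ i, X i ^ A i j : MvPolynomial (Fin n) K))).toLinearMap =
      (Ideal.Quotient.mkₐ K J).toLinearMap := by
    refine (basisMonomials (Fin m) K).ext fun u => ?_
    have hmk : ψ (monomial (toricDegree A u) 1) =
        Ideal.Quotient.mkₐ K J (monomial (Function.invFun (toricDegree A) (toricDegree A u)) 1) := by
      have h := (basisMonomials (Fin n) K).constr_basis K (fun t =>
        Ideal.Quotient.mkₐ K J (monomial (Function.invFun (toricDegree A) t) 1)) (toricDegree A u)
      rwa [coe_basisMonomials] at h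
    simp only [coe_basisMonomials, LinearMap.comp_apply, AlgHom.toLinearMap_apply,
      aeval_monomial_eq_toricDegree, hmk]
    exact Ideal.Quotient.eq.2 (hJ _ _ (Function.invFun_eq ⟨u, rfl⟩))
  intro p hp
  have h := LinearMap.congr_fun hψ p
  simp only [LinearMap.comp_apply, AlgHom.toLinearMap_apply, (mem_matToricIdeal K A p).1 hp,
    map_zero] at h
  exact Ideal.Quotient.eq_zero_iff_mem.1 h.symm

/-- An integer vector proportional over `ℚ` to `a` is an integer multiple of `a / gcd a`. -/
theorem exists_int_mul_div_gcd {ι : Type*} [Fintype ι] {a c : ι → ℤ} (ha : a ≠ 0) (r : ℚ)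
    (h : ∀ i, (c i : ℚ) = r * a i) :
    ∃ k : ℤ, ∀ i, c i = k * (a i / ((Finset.univ.gcd fun i => (a i).natAbs : ℕ) : ℤ)) := by
  set d := Finset.univ.gcd fun i => (a i).natAbs with hd
  have hd0 : d ≠ 0 := by
    intro h0
    rw [hd, Finset.gcd_eq_zero_iff] at h0
    exact ha (funext fun i => by simpa using h0 i (mem_univ i))
  have hdvd : ∀ i, (d : ℤ) ∣ a i := fun i =>
    Int.natCast_dvd.2 (Finset.gcd_dvd (f := fun i => (a i).natAbs) (mem_univ i))
  choose b hb using hdvd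
  have hdq : (d : ℚ) ≠ 0 := by exact_mod_cast hd0
  have hdz : (d : ℤ) ≠ 0 := by exact_mod_cast hd0
  set q : ℚ := r * d with hq
  have hcq : ∀ i, (c i : ℚ) = q * b i := fun i => by
    rw [h i, hb i]; push_cast; ring
  have hden : ∀ i, (q.den : ℤ) ∣ b i := fun i => by
    have h1 : (q.den : ℤ) * c i = q.num * b i := by
      have : (q.den : ℚ) * c i = q.num * b i := by
        rw [hcq i, ← mul_assoc, Rat.den_mul_eq_num]
      exact_mod_cast this
    refine IsCoprime.dvd_of_dvd_mul_left (z := b i) (y := q.num) ?_ ⟨c i, h1.symm⟩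
    exact (Rat.isCoprime_num_den q).symm
  have hden1 : q.den = 1 := by
    have h1 : d * q.den ∣ d := by
      conv_rhs => rw [hd]
      refine Finset.dvd_gcd fun i _ => Int.natCast_dvd.1 ?_
      rw [hb i]
      push_cast
      exact mul_dvd_mul_left _ (hden i)
    have h2 : d * q.den ∣ d * 1 := by simpa using h1
    exact Nat.dvd_one.1 (Nat.dvd_of_mul_dvd_mul_left (Nat.pos_of_ne_zero hd0) h2)
  refine ⟨q.num, fun i => ?_⟩
  rw [hb i, Int.mul_ediv_cancel_left _ hdz]
  have h1 := hcq i
  rw [← Rat.coe_int_num_of_den_eq_one hden1] at h1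
  exact_mod_cast h1

/-- If the null space is a line, an integer vector in it is an integer multiple of `a / gcd a` for
each nonzero integer vector `a` in it. -/
theorem exists_int_mul_div_gcd_of_finrank_ker_eq_one {n m : ℕ} (A : Matrix (Fin n) (Fin m) ℕ)
    (hnull : Module.finrank ℚ
      (LinearMap.ker (Matrix.mulVecLin (A.map (fun a => (a : ℚ))))) = 1)
    {a c : Fin m → ℤ} (ha : a ≠ 0) (haA : ∀ i, ∑ j, (A i j : ℤ) * a j = 0)
    (hcA : ∀ i, ∑ j, (A i j : ℤ) * c j = 0) :
    ∃ k : ℤ, ∀ i, c i = k * (a i / ((Finset.univ.gcd fun i => (a i).natAbs : ℕ) : ℤ)) := by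
  have hker : ∀ b : Fin m → ℤ, (∀ i, ∑ j, (A i j : ℤ) * b j = 0) →
      (fun j => (b j : ℚ)) ∈ LinearMap.ker (Matrix.mulVecLin (A.map (fun a => (a : ℚ)))) := by
    intro b hb
    rw [LinearMap.mem_ker]
    ext i
    simp only [Matrix.mulVecLin_apply, Matrix.mulVec, dotProduct, Matrix.map_apply, Pi.zero_apply]
    exact_mod_cast hb i
  obtain ⟨r, hr⟩ := (finrank_eq_one_iff_of_nonzero' ⟨_, hker a haA⟩ (fun h => ha (by
    have := Subtype.ext_iff.1 h
    ext i
    have := congrFun this i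
    simpa using this))).1 hnull ⟨_, hker c hcA⟩
  refine exists_int_mul_div_gcd ha r fun i => ?_
  have := congrFun (Subtype.ext_iff.1 hr) i
  simpa using this.symm

/-- If `u - v` is a natural multiple of `b`, then `f_b` divides `e^u - e^v`. -/
theorem binom_dvd_monomial_sub_monomial (K : Type*) [Field K] {ι : Type*} [Fintype ι]
    {b : ι → ℤ} (k : ℕ) {u v : ι →₀ ℕ} (h : ∀ i, (u i : ℤ) - v i = k * b i) :
    binom K b ∣ (monomial u 1 - monomial v 1 : MvPolynomial ι K) := by
  have hle : ∀ i, k * (b i).toNat ≤ u i ∧ u i - k * (b i).toNat = v i - k * (-b i).toNat ∧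
      k * (-b i).toNat ≤ v i := by
    intro i
    have hi := h i
    rcases le_total 0 (b i) with hb | hb
    · obtain ⟨t, ht⟩ := Int.eq_ofNat_of_zero_le hb
      rw [ht] at hi ⊢
      have h0 : (-(t : ℤ)).toNat = 0 := by omega
      rw [h0, Int.toNat_natCast, mul_zero]
      generalize hw : k * t = w
      have : (k : ℤ) * t = w := by rw [← hw]; push_cast; rfl
      omega
    · obtain ⟨t, ht⟩ := Int.eq_ofNat_of_zero_le (neg_nonneg.2 hb)
      have ht' : b i = -t := by omega
      rw [ht'] at hi ⊢
      have h0 : (-(t : ℤ)).toNat = 0 := by omega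
      rw [h0, neg_neg, Int.toNat_natCast, mul_zero]
      generalize hw : k * t = w
      have : (k : ℤ) * -t = -w := by rw [← hw]; push_cast; ring
      omega
  have hu : u = (u - k • posExponent b) + k • posExponent b := by
    ext i
    have := hle i
    simp only [posExponent, Finsupp.add_apply, Finsupp.tsub_apply, Finsupp.smul_apply,
      smul_eq_mul, Finsupp.equivFunOnFinite_symm_apply_apply]
    omega
  have hv : v = (u - k • posExponent b) + k • posExponent (-b) := by
    ext i
    have := hle i
    simp only [posExponent, Finsupp.add_apply, Finsupp.tsub_apply, Finsupp.smul_apply,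
      smul_eq_mul, Finsupp.equivFunOnFinite_symm_apply_apply, Pi.neg_apply]
    omega
  have hmon : ∀ w t : ι →₀ ℕ, (monomial (w + k • t) 1 : MvPolynomial ι K) =
      monomial w 1 * monomial t 1 ^ k := by
    intro w t
    rw [monomial_pow, monomial_mul]
    simp
  generalize u - k • posExponent b = w at hu hv
  rw [hu, hv, hmon, hmon, ← mul_sub, binom, binomPlus_eq_monomial, binomMinus_eq_monomial]
  exact (sub_dvd_pow_sub_pow _ _ k).mul_left _

/-- A nonzero integer multiple of `b` whose positive and negative parts divide those of `b`
is `b`. -/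
theorem int_mul_eq_self_of_toNat_le {ι : Type*} {b c : ι → ℤ} (hc : c ≠ 0) (k : ℤ)
    (hk : ∀ i, c i = k * b i) (hpos : ∀ i, (c i).toNat ≤ (b i).toNat)
    (hneg : ∀ i, (-c i).toNat ≤ (-b i).toNat) : c = b := by
  obtain ⟨i, hi⟩ := Function.ne_iff.1 hc
  simp only [Pi.zero_apply] at hi
  have hki := hk i
  have h1 := hpos i
  have h2 := hneg i
  have hk1 : k = 1 := by
    rcases lt_or_gt_of_ne hi with hlt | hgt
    · have : b i ≤ c i := by omega
      have : b i < 0 := by omega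
      have : 0 < k := by nlinarith
      nlinarith
    · have : c i ≤ b i := by omega
      have : 0 < k := by nlinarith
      nlinarith
  ext j
  rw [hk j, hk1, one_mul]

theorem posExponent_le_of_monomial_dvd (K : Type*) [Field K] {ι : Type*} [Fintype ι]
    {b c : ι → ℤ}
    (h : (monomial (posExponent c) 1 : MvPolynomial ι K) ∣ monomial (posExponent b) 1) (i : ι) :
    (c i).toNat ≤ (b i).toNat := by
  have := (monomial_dvd_monomial.1 h).1
  simpa [posExponent] using (this.resolve_left one_ne_zero) i

/-- Remark 4.3(ii). If the null space over `ℚ` of a matrix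
`A` of non-negative integers is one-dimensional and `f_a ∈ I_A` is a (pure)
binomial, then with `d = gcd(|a_i| : i ∈ supp a)`, the binomial `f_{(1/d)a}` is
primitive and generates `I_A`. -/
theorem stmt10 (K : Type*) [Field K] {n m : ℕ} (A : Matrix (Fin n) (Fin m) ℕ)
    (hnull : Module.finrank ℚ
      (LinearMap.ker (Matrix.mulVecLin (A.map (fun a => (a : ℚ))))) = 1)
    (a : Fin m → ℤ) (ha : a ≠ 0) (hmem : binom K a ∈ matToricIdeal K A)
    (d : ℕ) (hd : d = Finset.univ.gcd fun i => (a i).natAbs) :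
    IsPrimitiveIn K (matToricIdeal K A) (fun i => a i / (d : ℤ)) ∧
    matToricIdeal K A = Ideal.span {binom K fun i => a i / (d : ℤ)} := by
  subst hd
  set d := Finset.univ.gcd fun i => (a i).natAbs with hd
  have haA := (binom_mem_matToricIdeal K A a).1 hmem
  have hab : ∀ i, a i = d * (a i / (d : ℤ)) := fun i =>
    (Int.mul_ediv_cancel' (Int.natCast_dvd.2
      (Finset.gcd_dvd (f := fun i => (a i).natAbs) (mem_univ i)))).symm
  have hd0 : (d : ℤ) ≠ 0 := by
    intro h0
    exact ha (funext fun i => by rw [hab i, h0, zero_mul]; rfl)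
  have hbA : binom K (fun i => a i / (d : ℤ)) ∈ matToricIdeal K A := by
    refine (binom_mem_matToricIdeal K A _).2 fun i => ?_
    have h : (d : ℤ) * ∑ j, (A i j : ℤ) * (a j / (d : ℤ)) = 0 := by
      rw [← haA i, Finset.mul_sum]
      exact Finset.sum_congr rfl fun j _ => by rw [mul_left_comm, ← hab j]
    exact (mul_eq_zero.1 h).resolve_left hd0
  have hmul : ∀ c : Fin m → ℤ, (∀ i, ∑ j, (A i j : ℤ) * c j = 0) →
      ∃ k : ℤ, ∀ i, c i = k * (a i / (d : ℤ)) := fun c hc =>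
    exists_int_mul_div_gcd_of_finrank_ker_eq_one A hnull ha haA hc
  refine ⟨⟨fun h => ha (funext fun i => ?_), hbA, fun c hc hcI hp hn => ?_⟩, le_antisymm ?_ ?_⟩
  · rw [hab i, congrFun h i]
    simp
  · obtain ⟨k, hk⟩ := hmul c ((binom_mem_matToricIdeal K A c).1 hcI)
    rw [binomPlus_eq_monomial, binomPlus_eq_monomial] at hp
    rw [binomMinus_eq_monomial, binomMinus_eq_monomial] at hn
    exact int_mul_eq_self_of_toNat_le hc k hk (posExponent_le_of_monomial_dvd K hp)
      (posExponent_le_of_monomial_dvd K hn)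
  · refine matToricIdeal_le K A _ fun u v huv => Ideal.mem_span_singleton.2 ?_
    obtain ⟨k, hk⟩ := hmul (fun j => (u j : ℤ) - v j) ((toricDegree_eq_iff A u v).1 huv)
    obtain ⟨t, rfl | rfl⟩ := Int.eq_nat_or_neg k
    · exact binom_dvd_monomial_sub_monomial K t hk
    · rw [← neg_sub, dvd_neg]
      exact binom_dvd_monomial_sub_monomial K t fun i => by linarith [hk i]
  · exact (Ideal.span_singleton_le_iff_mem _).2 hbA
end
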